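/- arXiv:1006.2720 — 3 statements merged into one kernel-verified Lean document; each statement's English description precedes it below -/
import Mathlib

section
/- Let R be a commutative ring and N ⊆ R an ideal for which there exist integers m, k ≥ 1 with x^m = 0 for all x ∈ N and p^k·x = 0 for all x ∈ N. Then there exist integers M, K ≥ 1 such that every p-typical Witt vector ξ ∈ W(R) all of whose coefficients lie in N satisfies ξ^M = 0 and p^K·ξ = 0 in W(R). -/
namespace WittVector

variable {p : ℕ} [hp : Fact p.Prime] {R : Type*} [CommRing R]

theorem map_coeff_mul_p_pow {S : Type*} [CommRing S] (f : R →+* S) (x : WittVector p R) (r n : ℕ) :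
    f ((x * (p : WittVector p R) ^ r).coeff n) =
      (map f x * (p : WittVector p S) ^ r).coeff n := by
  rw [← map_coeff, map_mul, map_pow, map_natCast]

/-- If every element of the ideal `N` is killed by the `p ^ r`-th power map, then multiplication by
`p ^ r` maps Witt vectors with coefficients in `N` to Witt vectors with coefficients in `pN`. -/
theorem coeff_mul_p_pow_mem_of_pow_eq_zero {N : Ideal R} {r : ℕ}
    (hN : ∀ x ∈ N, x ^ p ^ r = 0) {ξ : WittVector p R} (hξ : ∀ n, ξ.coeff n ∈ N) (n : ℕ) :
    (ξ * (p : WittVector p R) ^ r).coeff n ∈ Ideal.span {(p : R)} * N := by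
  rw [Ideal.mem_span_singleton_mul]
  let η : WittVector p (MvPolynomial ℕ ℤ) := mk p MvPolynomial.X
  let T : MvPolynomial ℕ ℤ := if n < r then 0 else MvPolynomial.X (n - r) ^ p ^ r
  have dvd : MvPolynomial.C (p : ℤ) ∣
      (η * (p : WittVector p (MvPolynomial ℕ ℤ)) ^ r).coeff n - T := by
    rw [MvPolynomial.C_dvd_iff_zmod, map_sub, map_coeff_mul_p_pow, sub_eq_zero]
    by_cases h : n < r
    · simp [T, h, mul_pow_charP_coeff_zero]
    · obtain ⟨i, rfl⟩ := Nat.exists_eq_add_of_le' (not_lt.mp h)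
      simp [T, η, mul_pow_charP_coeff_succ, map_coeff]
  obtain ⟨Q, hQ⟩ := dvd
  have hQ0 : MvPolynomial.constantCoeff Q = 0 := by
    have hη : map (MvPolynomial.constantCoeff (R := ℤ)) η = 0 := by
      ext i
      simp [η, map_coeff]
    have hT : MvPolynomial.constantCoeff T = 0 := by
      unfold T
      split_ifs <;> simp [hp.out.ne_zero]
    have h := congrArg MvPolynomial.constantCoeff hQ
    rw [map_sub, map_coeff_mul_p_pow, hη, hT, map_mul, MvPolynomial.constantCoeff_C] at h
    simpa [hp.out.ne_zero] using h
  refine ⟨MvPolynomial.aeval ξ.coeff Q, ?_, ?_⟩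
  · have h : (fun i ↦ Ideal.Quotient.mkₐ ℤ N (ξ.coeff i)) = fun _ ↦ 0 :=
      funext fun i ↦ Ideal.Quotient.eq_zero_iff_mem.mpr (hξ i)
    rw [← Ideal.Quotient.eq_zero_iff_mem, ← Ideal.Quotient.mkₐ_eq_mk ℤ,
      ← AlgHom.comp_apply, MvPolynomial.comp_aeval, h, MvPolynomial.aeval_zero', hQ0, map_zero]
  · have hη : map (MvPolynomial.aeval (R := ℤ) ξ.coeff).toRingHom η = ξ := by
      ext i
      simp [η, map_coeff]
    have hT : MvPolynomial.aeval ξ.coeff T = 0 := by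
      unfold T
      split_ifs <;> simp [hN _ (hξ _)]
    have h := congrArg (MvPolynomial.aeval (R := ℤ) ξ.coeff).toRingHom hQ
    rw [map_sub, map_coeff_mul_p_pow, hη, map_mul] at h
    simpa [hT] using h.symm

theorem mul_p_pow_eq_zero_of_pow_eq_zero {r : ℕ} (k : ℕ) (N : Ideal R)
    (hN : ∀ x ∈ N, x ^ p ^ r = 0) (hNk : ∀ x ∈ N, (p : R) ^ k * x = 0)
    {ξ : WittVector p R} (hξ : ∀ n, ξ.coeff n ∈ N) :
    ξ * (p : WittVector p R) ^ (r * k) = 0 := by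
  induction k generalizing N ξ with
  | zero =>
    have : ξ = 0 := by
      ext n
      simpa using hNk _ (hξ n)
    simp [this]
  | succ k ih =>
    rw [Nat.mul_succ, add_comm, pow_add, ← mul_assoc]
    refine ih (Ideal.span {(p : R)} * N) (fun x hx ↦ hN x (Ideal.mul_le_right (I := Ideal.span {(p : R)}) hx)) ?_
      (coeff_mul_p_pow_mem_of_pow_eq_zero hN hξ)
    intro x hx
    obtain ⟨y, hy, rfl⟩ := Ideal.mem_span_singleton_mul.mp hx
    rw [← mul_assoc, ← pow_succ, hNk y hy]

theorem iterate_verschiebung_mul_iterate_verschiebung (i : ℕ) (x y : WittVector p R) :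
    verschiebung^[i] x * verschiebung^[i] y =
      verschiebung^[i] (x * y * (p : WittVector p R) ^ i) := by
  induction i generalizing x y with
  | zero => simp
  | succ i ih =>
    have h : verschiebung x * verschiebung y * (p : WittVector p R) ^ i =
        verschiebung (x * y * (p : WittVector p R) ^ (i + 1)) := by
      rw [mul_assoc, ← verschiebung_mul_frobenius, map_mul frobenius, frobenius_verschiebung,
        map_pow, map_natCast]
      ring_nf
    simp only [Function.iterate_succ_apply]
    rw [ih, h]

theorem iterate_verschiebung_zero (i : ℕ) : verschiebung^[i] (0 : WittVector p R) = 0 :=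
  iterate_map_zero _ i

theorem iterate_verschiebung_pow_succ (i t : ℕ) (x : WittVector p R) :
    (verschiebung^[i] x) ^ (t + 1) =
      verschiebung^[i] (x ^ (t + 1) * (p : WittVector p R) ^ (i * t)) := by
  induction t with
  | zero => simp
  | succ t ih =>
    rw [pow_succ, ih, iterate_verschiebung_mul_iterate_verschiebung]
    ring_nf

theorem teichmuller_add_verschiebung_shift (x : WittVector p R) :
    teichmuller p (x.coeff 0) + verschiebung (x.shift 1) = x := by
  ext n
  rw [coeff_add_of_disjoint]
  · cases n <;> simp [teichmuller_coeff_pos, shift_coeff, verschiebung_coeff_succ, add_comm]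
  · intro n
    cases n <;> simp [teichmuller_coeff_pos]

/-- If `p ^ K` annihilates all Witt vectors with coefficients in `N`, then nilpotency of bounded
order in `N` gives nilpotency of bounded order for those Witt vectors. -/
theorem iterate_verschiebung_pow_eq_zero {N : Ideal R} {m K : ℕ} (hm : m ≠ 0)
    (hN : ∀ x ∈ N, x ^ m = 0)
    (hK : ∀ ξ : WittVector p R, (∀ n, ξ.coeff n ∈ N) → ξ * (p : WittVector p R) ^ K = 0)
    (j i : ℕ) (hij : K ≤ i + j) {ξ : WittVector p R} (hξ : ∀ n, ξ.coeff n ∈ N) :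
    (verschiebung^[i] ξ) ^ (2 + j * m) = 0 := by
  induction j generalizing i ξ with
  | zero =>
    obtain ⟨d, rfl⟩ := Nat.exists_eq_add_of_le hij
    have h : ξ * ξ * (p : WittVector p R) ^ (K + d) = 0 := by
      rw [mul_assoc, pow_add, ← mul_assoc ξ (_ ^ K), hK ξ hξ, zero_mul, mul_zero]
    rw [zero_mul, add_zero, sq, iterate_verschiebung_mul_iterate_verschiebung, h,
      iterate_verschiebung_zero]
  | succ j ih =>
    have htail : (verschiebung^[i + 1] (ξ.shift 1)) ^ (2 + j * m) = 0 :=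
      ih (i + 1) (by omega) fun n ↦ by simpa [shift_coeff] using hξ (1 + n)
    have hhead : (verschiebung^[i] (teichmuller p (ξ.coeff 0))) ^ m = 0 := by
      obtain ⟨t, rfl⟩ := Nat.exists_eq_succ_of_ne_zero hm
      rw [Nat.succ_eq_add_one, iterate_verschiebung_pow_succ, ← map_pow, hN _ (hξ 0),
        teichmuller_zero, zero_mul, iterate_verschiebung_zero]
    rw [← teichmuller_add_verschiebung_shift ξ, iterate_map_add,
      ← Function.iterate_succ_apply]
    exact (Commute.all _ _).add_pow_eq_zero_of_add_le_succ_of_pow_eq_zero hhead htail (by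
      rw [Nat.succ_mul]; omega)

end WittVector


/-- If `N ⊆ R` is an ideal with `x^m = 0` and `p^k·x = 0` for
all `x ∈ N` (for some fixed `m, k ≥ 1`), then there are `M, K ≥ 1` such that
every Witt vector with all coefficients in `N` satisfies `ξ^M = 0` and
`p^K·ξ = 0` in `W(R)`. -/
theorem witt_of_bounded_nilpotent_ideal_bounded_nilpotent (p : ℕ) [Fact p.Prime]
    (R : Type*) [CommRing R] (N : Ideal R)
    (m k : ℕ) (hm : 1 ≤ m) (hk : 1 ≤ k)
    (hNm : ∀ x ∈ N, x ^ m = 0) (hNk : ∀ x ∈ N, p ^ k • x = 0) :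
    ∃ M K : ℕ, 1 ≤ M ∧ 1 ≤ K ∧
      ∀ ξ : WittVector p R, (∀ n, ξ.coeff n ∈ N) →
        ξ ^ M = 0 ∧ p ^ K • ξ = 0 := by
  have hp : p.Prime := Fact.out
  have hNp : ∀ x ∈ N, x ^ p ^ m = 0 := fun x hx ↦
    pow_eq_zero_of_le (Nat.lt_pow_self hp.one_lt).le (hNm x hx)
  have hK : ∀ ξ : WittVector p R, (∀ n, ξ.coeff n ∈ N) →
      ξ * (p : WittVector p R) ^ (m * k) = 0 := fun ξ hξ ↦
    WittVector.mul_p_pow_eq_zero_of_pow_eq_zero k N hNp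
      (fun x hx ↦ by simpa using hNk x hx) hξ
  refine ⟨2 + m * k * m, m * k, by omega, Nat.mul_pos hm hk, fun ξ hξ ↦ ⟨?_, ?_⟩⟩
  · exact WittVector.iterate_verschiebung_pow_eq_zero (by omega) hNm hK (m * k) 0 (by omega) hξ
  · rw [nsmul_eq_mul, Nat.cast_pow, mul_comm, hK ξ hξ]
end

section
/- Let R be an admissible ring. Then the ring homomorphism π : W(R) → W(R_red) induced by the projection R → R_red admits exactly one ring-homomorphism section s : W(R_red) → W(R) (i.e. π ∘ s = id), and this unique section commutes with the Frobenius: s ∘ f = f ∘ s. -/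
namespace WittVector

variable {p : ℕ} [hp : Fact p.Prime] {R A : Type*} [CommRing R] [CommRing A]

theorem map_frobenius_apply (φ : R →+* A) (x : WittVector p R) :
    map φ (frobenius x) = frobenius (map φ x) := by
  ext n
  rw [map_coeff, coeff_frobenius, coeff_frobenius, MvPolynomial.aeval_def, MvPolynomial.aeval_def,
    MvPolynomial.hom_eval₂, RingHom.ext_int (φ.comp (algebraMap ℤ R)) (algebraMap ℤ A)]
  congr 1

theorem frobenius_teichmuller (x : R) :
    frobenius (teichmuller p x) = teichmuller p (x ^ p) := by
  have hrat (y : MvPolynomial R ℚ) : frobenius (teichmuller p y) = teichmuller p (y ^ p) := by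
    apply (ghostMap.bijective_of_invertible p (MvPolynomial R ℚ)).1
    ext1 n
    simp only [ghostMap_apply, ghostComponent_frobenius, ghostComponent_teichmuller, ← pow_mul,
      pow_succ']
  have hint (y : MvPolynomial R ℤ) : frobenius (teichmuller p y) = teichmuller p (y ^ p) := by
    refine map_injective (MvPolynomial.map (Int.castRingHom ℚ))
      (MvPolynomial.map_injective _ Int.cast_injective) ?_
    simp only [map_frobenius_apply, map_teichmuller, hrat, map_pow]
  rcases MvPolynomial.counit_surjective R x with ⟨y, rfl⟩
  rw [← map_pow, ← map_teichmuller, ← map_teichmuller, ← map_frobenius_apply, hint]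

theorem exists_eq_teichmuller_add_verschiebung (x : WittVector p R) :
    ∃ y, x = teichmuller p (x.coeff 0) + verschiebung y := by
  have h0 : (x - teichmuller p (x.coeff 0)).coeff 0 = 0 := by
    change constantCoeff (x - teichmuller p (x.coeff 0)) = 0
    rw [map_sub]
    simp
  refine ⟨(x - teichmuller p (x.coeff 0)).shift 1, ?_⟩
  have h := eq_iterate_verschiebung (x := x - teichmuller p (x.coeff 0)) (n := 1)
    (by intro i hi; obtain rfl : i = 0 := by omega
        exact h0)
  rw [Function.iterate_one] at h
  rw [← h, add_sub_cancel]

theorem verschiebung_natCast_pow_mul (k : ℕ) (x : WittVector p R) :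
    verschiebung ((p : WittVector p R) ^ k * x) = (p : WittVector p R) ^ k * verschiebung x := by
  have h := verschiebung_mul_frobenius x ((p : WittVector p R) ^ k)
  rw [map_pow, map_natCast] at h
  rw [mul_comm, h, mul_comm]

theorem natCast_pow_mul_teichmuller_eq_zero (n : ℕ) : ∀ (a b : ℕ) (_ : a + b = n) (x : R)
    (_ : (p : R) ^ a * x = 0) (_ : x ^ p ^ b = 0),
    (p : WittVector p R) ^ n * teichmuller p x = 0 := by
  induction n with
  | zero =>
    intro a b hab x hx _
    obtain rfl : a = 0 := by omega
    have : x = 0 := by simpa using hx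
    simp [this]
  | succ n ih =>
    intro a b hab x hx hxb
    rcases Nat.eq_zero_or_pos a with rfl | ha
    · have : x = 0 := by simpa using hx
      simp [this]
    rcases Nat.eq_zero_or_pos b with rfl | hb
    · have : x = 0 := by simpa using hxb
      simp [this]
    obtain ⟨a, rfl⟩ := Nat.exists_eq_succ_of_ne_zero ha.ne'
    obtain ⟨b, rfl⟩ := Nat.exists_eq_succ_of_ne_zero hb.ne'
    obtain ⟨y, hy⟩ := exists_eq_teichmuller_add_verschiebung (p : WittVector p R)
    have hp0 : (p : WittVector p R).coeff 0 = p :=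
      map_natCast (constantCoeff : WittVector p R →+* R) p
    rw [hp0] at hy
    have h1 : (p : WittVector p R) * teichmuller p x =
        teichmuller p (p * x) + verschiebung (y * teichmuller p (x ^ p)) := by
      rw [← frobenius_teichmuller, verschiebung_mul_frobenius, map_mul (teichmuller p),
        ← add_mul, ← hy]
    rw [pow_succ, mul_assoc, h1, mul_add, ← verschiebung_natCast_pow_mul,
      ih a (b + 1) (by omega) (p * x) (by rw [← mul_assoc, ← pow_succ, hx])
        (by rw [mul_pow, hxb, mul_zero]),
      mul_left_comm, ih (a + 1) b (by omega) (x ^ p)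
        (by rw [← mul_pow_sub_one hp.out.ne_zero x, ← mul_assoc, hx, zero_mul])
        (by rw [← pow_mul, ← pow_succ', hxb])]
    simp

section Kernel

variable {φ : R →+* A} {m : ℕ}

theorem exists_eq_teichmuller_add_verschiebung_of_map_eq_zero {x : WittVector p R}
    (hx : map φ x = 0) :
    ∃ y, map φ y = 0 ∧ φ (x.coeff 0) = 0 ∧ x = teichmuller p (x.coeff 0) + verschiebung y := by
  obtain ⟨y, hy⟩ := exists_eq_teichmuller_add_verschiebung x
  have h0 : φ (x.coeff 0) = 0 := by rw [← map_coeff, hx, zero_coeff]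
  refine ⟨y, ?_, h0, hy⟩
  apply verschiebung_injective p A
  rw [hy, map_add, map_teichmuller, h0, teichmuller_zero, zero_add, map_verschiebung] at hx
  rw [hx, map_zero]

theorem natCast_pow_mul_eq_zero_of_map_eq_zero (hm : ∀ x, φ x = 0 → x ^ m = 0)
    (hpm : (p : R) ^ m = 0) {x : WittVector p R} (hx : map φ x = 0) :
    (p : WittVector p R) ^ (m + m) * x = 0 := by
  ext i
  rw [zero_coeff]
  induction i generalizing x with
  | zero =>
    obtain ⟨y, -, h0, h⟩ := exists_eq_teichmuller_add_verschiebung_of_map_eq_zero hx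
    rw [h, mul_add, natCast_pow_mul_teichmuller_eq_zero _ m m rfl _ (by rw [hpm, zero_mul])
      (pow_eq_zero_of_le (Nat.lt_pow_self hp.out.one_lt).le (hm _ h0)), zero_add,
      ← verschiebung_natCast_pow_mul, verschiebung_coeff_zero]
  | succ i ih =>
    obtain ⟨y, hy, h0, h⟩ := exists_eq_teichmuller_add_verschiebung_of_map_eq_zero hx
    rw [h, mul_add, natCast_pow_mul_teichmuller_eq_zero _ m m rfl _ (by rw [hpm, zero_mul])
      (pow_eq_zero_of_le (Nat.lt_pow_self hp.out.one_lt).le (hm _ h0)), zero_add,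
      ← verschiebung_natCast_pow_mul, verschiebung_coeff_succ, ih hy]

theorem map_frobenius_pow_apply (φ : R →+* A) (n : ℕ) (x : WittVector p R) :
    map φ ((frobenius ^ n : WittVector p R →+* WittVector p R) x) =
      (frobenius ^ n : WittVector p A →+* WittVector p A) (map φ x) := by
  induction n generalizing x with
  | zero => rfl
  | succ n ih => simp only [pow_succ, RingHom.mul_def, RingHom.comp_apply, ih, map_frobenius_apply]

theorem frobenius_pow_teichmuller (n : ℕ) (x : R) :
    (frobenius ^ n : WittVector p R →+* WittVector p R) (teichmuller p x) =
      teichmuller p (x ^ p ^ n) := by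
  induction n generalizing x with
  | zero => simp
  | succ n ih =>
    simp only [pow_succ, RingHom.mul_def, RingHom.comp_apply, frobenius_teichmuller, ih]
    rw [← pow_mul, mul_comm]

theorem exists_frobenius_pow_eq_of_map_eq_zero (hm : ∀ x, φ x = 0 → x ^ m = 0) (j : ℕ)
    {x : WittVector p R} (hx : map φ x = 0) :
    ∃ y, map φ y = 0 ∧ (frobenius ^ (m + j) : WittVector p R →+* WittVector p R) x =
      (p : WittVector p R) ^ j * y := by
  induction j generalizing x with
  | zero =>
    exact ⟨(frobenius ^ m : WittVector p R →+* WittVector p R) x,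
      by rw [map_frobenius_pow_apply, hx, map_zero], by simp⟩
  | succ j ih =>
    obtain ⟨y, hy, h0, h⟩ := exists_eq_teichmuller_add_verschiebung_of_map_eq_zero hx
    obtain ⟨z, hz, hyz⟩ := ih hy
    refine ⟨z, hz, ?_⟩
    have hle : m ≤ p ^ (m + (j + 1)) := by
      have := (Nat.lt_pow_self hp.out.one_lt (n := m + (j + 1)))
      omega
    rw [h, map_add, frobenius_pow_teichmuller, pow_eq_zero_of_le hle (hm _ h0), teichmuller_zero,
      zero_add, ← add_assoc, pow_succ, RingHom.mul_def, RingHom.comp_apply, frobenius_verschiebung,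
      map_mul, map_natCast, hyz]
    ring

theorem frobenius_pow_eq_zero_of_map_eq_zero (hm : ∀ x, φ x = 0 → x ^ m = 0)
    (hpm : (p : R) ^ m = 0) {x : WittVector p R} (hx : map φ x = 0) :
    (frobenius ^ (m + (m + m)) : WittVector p R →+* WittVector p R) x = 0 := by
  obtain ⟨y, hy, h⟩ := exists_frobenius_pow_eq_of_map_eq_zero hm (m + m) hx
  rw [h, natCast_pow_mul_eq_zero_of_map_eq_zero hm hpm hy]

theorem verschiebung_pow_succ (x : WittVector p R) (j : ℕ) :
    verschiebung x ^ (j + 1) = verschiebung ((p : WittVector p R) ^ j * x ^ (j + 1)) := by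
  induction j with
  | zero => simp
  | succ j ih =>
    rw [pow_succ, ih, ← verschiebung_mul_frobenius, frobenius_verschiebung]
    congr 1
    ring

theorem pow_eq_zero_of_map_eq_zero (hm : ∀ x, φ x = 0 → x ^ m = 0)
    (hpm : (p : R) ^ m = 0) {x : WittVector p R} (hx : map φ x = 0) :
    x ^ (m + (m + m + 1)) = 0 := by
  obtain ⟨y, hy, h0, h⟩ := exists_eq_teichmuller_add_verschiebung_of_map_eq_zero hx
  rw [h]
  refine (Commute.all _ _).add_pow_eq_zero_of_add_le_succ_of_pow_eq_zero (m := m)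
    (n := m + m + 1) ?_ ?_ (by omega)
  · rw [← map_pow, hm _ h0, teichmuller_zero]
  · rw [verschiebung_pow_succ, natCast_pow_mul_eq_zero_of_map_eq_zero hm hpm, map_zero]
    rw [map_pow, hy, zero_pow (by omega)]

theorem exists_pow_eq_pow_of_map_eq (hm : ∀ x, φ x = 0 → x ^ m = 0) (hpm : (p : R) ^ m = 0) :
    ∃ n : ℕ, ∀ x y : WittVector p R, map φ x = map φ y → x ^ p ^ n = y ^ p ^ n := by
  set M := m + (m + m + 1) with hM
  have key (j : ℕ) (x y : WittVector p R) (hxy : map φ x = map φ y) :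
      ∃ z, map φ z = 0 ∧ x ^ p ^ (M * j) = y ^ p ^ (M * j) + (p : WittVector p R) ^ j * z := by
    induction j with
    | zero => exact ⟨x - y, by rw [map_sub, hxy, sub_self], by simp⟩
    | succ j ih =>
      obtain ⟨z, hz, h⟩ := ih
      obtain ⟨r, hr⟩ := exists_add_pow_prime_pow_eq hp.out (y ^ p ^ (M * j))
        ((p : WittVector p R) ^ j * z) M
      have h0 : ((p : WittVector p R) ^ j * z) ^ p ^ M = 0 :=
        pow_eq_zero_of_le (Nat.lt_pow_self hp.out.one_lt).le
          (pow_eq_zero_of_map_eq_zero hm hpm (by rw [map_mul, hz, mul_zero]))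
      refine ⟨z * (y ^ p ^ (M * j) * r), by rw [map_mul, hz, zero_mul], ?_⟩
      rw [Nat.mul_succ, pow_add, pow_mul, h, hr, h0, ← pow_mul]
      ring
  refine ⟨M * (m + m), fun x y hxy => ?_⟩
  obtain ⟨z, hz, h⟩ := key (m + m) x y hxy
  rw [h, natCast_pow_mul_eq_zero_of_map_eq_zero hm hpm hz, add_zero]

end Kernel

theorem frobenius_bijective_of_natCast_eq_zero (hpA : (p : A) = 0)
    (hA : Function.Bijective fun x : A => x ^ p) :
    Function.Bijective (frobenius : WittVector p A →+* WittVector p A) := by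
  cases subsingleton_or_nontrivial A
  · have : Subsingleton (WittVector p A) := ⟨fun x y => ext fun _ => Subsingleton.elim _ _⟩
    exact ⟨Function.injective_of_subsingleton _, Function.surjective_to_subsingleton _⟩
  · have : CharP A p := ringChar.of_eq (CharP.ringChar_of_prime_eq_zero hp.out hpA)
    have : PerfectRing A p := ⟨hA⟩
    exact frobenius_bijective p A

theorem exists_eq_teichmuller_add_natCast_mul (hpA : (p : A) = 0)
    (hA : Function.Bijective fun x : A => x ^ p) (x : WittVector p A) :
    ∃ y, x = teichmuller p (x.coeff 0) + p * y := by
  cases subsingleton_or_nontrivial A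
  · exact ⟨0, ext fun _ => Subsingleton.elim _ _⟩
  · have : CharP A p := ringChar.of_eq (CharP.ringChar_of_prime_eq_zero hp.out hpA)
    obtain ⟨y, hy⟩ := exists_eq_teichmuller_add_verschiebung x
    obtain ⟨z, rfl⟩ := (frobenius_bijective_of_natCast_eq_zero hpA hA).2 y
    exact ⟨z, by rw [mul_comm, ← verschiebung_frobenius, ← hy]⟩

section Section

variable {φ : R →+* A} {m : ℕ}

theorem section_unique (hm : ∀ x, φ x = 0 → x ^ m = 0) (hpm : (p : R) ^ m = 0) (hpA : (p : A) = 0)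
    (hA : Function.Bijective fun x : A => x ^ p) {s t : WittVector p A →+* WittVector p R}
    (hs : (map φ).comp s = RingHom.id _) (ht : (map φ).comp t = RingHom.id _) : s = t := by
  have hst (y : WittVector p A) : map φ (s y) = map φ (t y) :=
    (RingHom.congr_fun hs y).trans (RingHom.congr_fun ht y).symm
  obtain ⟨n, hn⟩ := exists_pow_eq_pow_of_map_eq hm hpm (p := p)
  have hT (a : A) : s (teichmuller p a) = t (teichmuller p a) := by
    obtain ⟨b, rfl⟩ : ∃ b : A, b ^ p ^ n = a := by
      have := (hA.iterate n).2 a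
      rwa [pow_iterate] at this
    rw [map_pow, map_pow, map_pow]
    exact hn _ _ (hst _)
  have key (k : ℕ) (y : WittVector p A) :
      ∃ z, s y - t y = (p : WittVector p R) ^ k * (s z - t z) := by
    induction k with
    | zero => exact ⟨y, by simp⟩
    | succ k ih =>
      obtain ⟨z, hz⟩ := ih
      obtain ⟨w, hw⟩ := exists_eq_teichmuller_add_natCast_mul hpA hA z
      refine ⟨w, ?_⟩
      rw [hz, hw, map_add, map_add, hT, map_mul, map_mul, map_natCast, map_natCast]
      ring
  ext1 y
  obtain ⟨z, hz⟩ := key (m + m) y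
  rw [← sub_eq_zero, hz]
  exact natCast_pow_mul_eq_zero_of_map_eq_zero hm hpm (by rw [map_sub, hst, sub_self])

theorem exists_section (hφ : Function.Surjective φ) (hm : ∀ x, φ x = 0 → x ^ m = 0)
    (hpm : (p : R) ^ m = 0) (hpA : (p : A) = 0) (hA : Function.Bijective fun x : A => x ^ p) :
    ∃ s : WittVector p A →+* WittVector p R, (map φ).comp s = RingHom.id _ ∧
      ∀ y, s (frobenius y) = frobenius (s y) := by
  set n := m + (m + m)
  let F : WittVector p R →+* WittVector p R := frobenius ^ n
  let G : WittVector p A →+* WittVector p A := frobenius ^ n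
  have hG : Function.Bijective G := by
    have := (frobenius_bijective_of_natCast_eq_zero hpA hA).iterate n
    rwa [← RingHom.coe_pow] at this
  let e : WittVector p A ≃+* WittVector p A := RingEquiv.ofBijective G hG
  have hsurj : Function.Surjective (map φ : WittVector p R →+* WittVector p A) :=
    map_surjective φ hφ
  let g : WittVector p A →+* WittVector p R := (map φ).liftOfSurjective hsurj
    ⟨F, fun x hx => frobenius_pow_eq_zero_of_map_eq_zero hm hpm hx⟩
  have hg (x : WittVector p R) : g (map φ x) = F x :=
    RingHom.liftOfRightInverse_comp_apply _ _ _ _ x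
  let s := g.comp e.symm.toRingHom
  have hs (x : WittVector p R) : s (G (map φ x)) = F x := by
    rw [← hg]
    exact congrArg g (e.symm_apply_apply _)
  refine ⟨s, ?_, fun y => ?_⟩
  · ext1 y
    obtain ⟨z, rfl⟩ := hG.2 y
    obtain ⟨x, rfl⟩ := hsurj z
    rw [RingHom.comp_apply, hs, RingHom.id_apply]
    exact map_frobenius_pow_apply φ n x
  · obtain ⟨z, rfl⟩ := hG.2 y
    obtain ⟨x, rfl⟩ := hsurj z
    have hcG (z : WittVector p A) : frobenius (G z) = G (frobenius z) :=
      RingHom.congr_fun (Commute.self_pow (frobenius : WittVector p A →+* _) n).eq z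
    have hcF (z : WittVector p R) : frobenius (F z) = F (frobenius z) :=
      RingHom.congr_fun (Commute.self_pow (frobenius : WittVector p R →+* _) n).eq z
    rw [hcG, ← map_frobenius_apply, hs, hs, hcF]

end Section

end WittVector


/-- A commutative ring `R` is *admissible* (for the prime `p`) if its
nilradical `N_R` is bounded nilpotent and `R_red = R/N_R` is a perfect ring of
characteristic `p`. -/
def IsAdmissible (p : ℕ) (R : Type*) [CommRing R] : Prop :=
  (∃ m : ℕ, 1 ≤ m ∧ ∀ x ∈ nilradical R, x ^ m = 0) ∧
  (p : R ⧸ nilradical R) = 0 ∧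
  Function.Bijective fun x : R ⧸ nilradical R => x ^ p

/-- For an admissible ring `R`, the projection
`π : W(R) → W(R_red)` admits exactly one ring-homomorphism section `s`, and any
such section commutes with the Frobenius. -/
theorem zink_section_exists_unique_and_frobenius_equivariant
    (p : ℕ) [Fact p.Prime] (R : Type*) [CommRing R] (hR : IsAdmissible p R) :
    (∃! s : WittVector p (R ⧸ nilradical R) →+* WittVector p R,
      (WittVector.map (Ideal.Quotient.mk (nilradical R))).comp s = RingHom.id _) ∧
    (∀ s : WittVector p (R ⧸ nilradical R) →+* WittVector p R,
      (WittVector.map (Ideal.Quotient.mk (nilradical R))).comp s = RingHom.id _ →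
      ∀ y : WittVector p (R ⧸ nilradical R),
        s (WittVector.frobenius y) = WittVector.frobenius (s y)) := by
  obtain ⟨⟨m, -, hm⟩, hp0, hperf⟩ := hR
  have hker (x : R) (hx : Ideal.Quotient.mk (nilradical R) x = 0) : x ^ m = 0 :=
    hm x (Ideal.Quotient.eq_zero_iff_mem.mp hx)
  have hpm : (p : R) ^ m = 0 := hker _ (by rw [map_natCast, hp0])
  obtain ⟨s, hs, hsF⟩ :=
    WittVector.exists_section Ideal.Quotient.mk_surjective hker hpm hp0 hperf
  refine ⟨⟨s, hs, fun t ht => WittVector.section_unique hker hpm hp0 hperf ht hs⟩,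
    fun t ht => ?_⟩
  rw [WittVector.section_unique hker hpm hp0 hperf ht hs]
  exact hsF
end

section
/- Let p = 2 and let R be an admissible ring. The element 2·1 − [2·1_R] of W(R) has zeroth coefficient 0, hence equals v(u_0) for a unique u_0 ∈ W(R), and u_0 is a unit of W(R). Then: (a) for every x ∈ 𝕎(R) one has v(u_0·x) ∈ 𝕎(R); (b) for every x ∈ 𝕎(R) with w_0(x) = 0 there exists y ∈ 𝕎(R) with x = v(u_0·y); (c) the map w_0 : 𝕎(R) → R is surjective (so that 0 → 𝕎(R) →𝕧 𝕎(R) →w_0 R → 0 is exact, where 𝕧(x) = v(u_0·x)). -/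
/-- `Ŵ(N_R)`: the set of Witt vectors all of whose coefficients are nilpotent
and all but finitely many are zero. -/
def hatW (p : ℕ) (R : Type*) [CommRing R] : Set (WittVector p R) :=
  {x | (∀ n, IsNilpotent (x.coeff n)) ∧ ∃ N, ∀ n ≥ N, x.coeff n = 0}

/-- The Zink ring `𝕎(R) = {s(y) + z : y ∈ W(R_red), z ∈ Ŵ(N_R)}`, as a subset
of `W(R)`, relative to a section `s : W(R_red) → W(R)`. -/
def zinkSet (p : ℕ) [Fact p.Prime] (R : Type*) [CommRing R]
    (s : WittVector p (R ⧸ nilradical R) →+* WittVector p R) :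
    Set (WittVector p R) :=
  {w | ∃ (y : WittVector p (R ⧸ nilradical R)) (z : WittVector p R),
        z ∈ hatW p R ∧ w = s y + z}

theorem IsAdmissible.isNilpotent {p : ℕ} {R : Type*} [CommRing R] (hR : IsAdmissible p R) :
    IsNilpotent (p : R) := by
  rw [← mem_nilradical, ← Ideal.Quotient.eq_zero_iff_mem, map_natCast]
  exact hR.2.1

namespace WittVector

section Generic

variable {p : ℕ} [hp : Fact p.Prime] {R : Type*} [CommRing R]

theorem mem_ker_map_mk {I : Ideal R} {x : WittVector p R} :
    x ∈ RingHom.ker (map (p := p) (Ideal.Quotient.mk I)) ↔ ∀ n, x.coeff n ∈ I := by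
  simp only [RingHom.mem_ker, WittVector.ext_iff, map_coeff, zero_coeff,
    Ideal.Quotient.eq_zero_iff_mem]

theorem map_frobenius {S : Type*} [CommRing S] (f : R →+* S) (x : WittVector p R) :
    map f (frobenius x) = frobenius (map f x) := by
  ext n
  simp only [map_coeff, coeff_frobenius]
  rw [← RingHom.coe_coe, MvPolynomial.map_aeval]
  simp only [MvPolynomial.aeval_def, MvPolynomial.coe_eval₂Hom]
  congr 1
  exact RingHom.ext_int _ _

private theorem teichmuller_mul_of_invertible [Invertible (p : R)] (r : R) (x : WittVector p R) :
    teichmuller p r * x = WittVector.mk p fun n => r ^ p ^ n * x.coeff n := by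
  apply (ghostMap.bijective_of_invertible p R).1
  rw [map_mul]
  ext1 n
  simp only [Pi.mul_apply, ghostMap_apply, ghostComponent_teichmuller]
  simp only [ghostComponent_apply, aeval_wittPolynomial, coeff_mk, Finset.mul_sum]
  refine Finset.sum_congr rfl fun i hi => ?_
  have hi : i ≤ n := Nat.lt_succ_iff.1 (Finset.mem_range.1 hi)
  rw [mul_pow, ← pow_mul, ← pow_add, Nat.add_sub_cancel' hi]
  ring

/-- Multiplication by a Teichmüller representative scales the Witt coordinates. -/
theorem coeff_teichmuller_mul (r : R) (x : WittVector p R) (n : ℕ) :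
    (teichmuller p r * x).coeff n = r ^ p ^ n * x.coeff n := by
  have key (a : MvPolynomial R ℤ) (y : WittVector p (MvPolynomial R ℤ)) :
      teichmuller p a * y = WittVector.mk p fun n => a ^ p ^ n * y.coeff n := by
    refine map_injective (MvPolynomial.map (Int.castRingHom ℚ))
      (MvPolynomial.map_injective _ Int.cast_injective) ?_
    rw [map_mul, map_teichmuller, teichmuller_mul_of_invertible]
    ext n
    simp
  let f : MvPolynomial R ℤ →+* R := (MvPolynomial.aeval id : MvPolynomial R ℤ →ₐ[ℤ] R).toRingHom
  have hf (a : R) : f (MvPolynomial.X a) = a := by simp [f]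
  have h := congr_arg (map f)
    (key (MvPolynomial.X r) (WittVector.mk p fun n => MvPolynomial.X (x.coeff n)))
  have hx : map f (WittVector.mk p fun n => MvPolynomial.X (x.coeff n)) = x := by
    ext n
    simp [hf]
  rw [map_mul, map_teichmuller, hf, hx] at h
  rw [h]
  simp [hf]

theorem constantCoeff_frobeniusPolyAux (n : ℕ) :
    MvPolynomial.constantCoeff (frobeniusPolyAux p n) = 0 := by
  have h := coeff_frobenius (0 : WittVector p ℤ) n
  have h0 : (0 : WittVector p ℤ).coeff = 0 := by
    ext i
    simp
  rw [map_zero, h0, MvPolynomial.aeval_zero, frobeniusPoly] at h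
  simpa [hp.out.ne_zero] using h

/-- The Frobenius maps `W(I)` into `W(J)` as soon as `J` contains `p I` and all `p`-th powers of
elements of `I`. -/
theorem frobenius_coeff_mem {I J : Ideal R} (hpow : ∀ a ∈ I, a ^ p ∈ J)
    (hmul : ∀ a ∈ I, (p : R) * a ∈ J) {x : WittVector p R} (hx : ∀ n, x.coeff n ∈ I) (n : ℕ) :
    (frobenius x).coeff n ∈ J := by
  have haux : MvPolynomial.aeval x.coeff (frobeniusPolyAux p n) ∈ I := by
    rw [← Ideal.Quotient.eq_zero_iff_mem, ← RingHom.coe_coe, MvPolynomial.map_aeval]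
    have h0 : (fun i => Ideal.Quotient.mk I (x.coeff i)) = 0 := by
      ext i
      exact Ideal.Quotient.eq_zero_iff_mem.2 (hx i)
    simp [h0, constantCoeff_frobeniusPolyAux]
  rw [coeff_frobenius, frobeniusPoly, map_add, map_pow, map_mul, MvPolynomial.aeval_X,
    MvPolynomial.aeval_C]
  refine J.add_mem (hpow _ (hx n)) ?_
  simpa using hmul _ haux

theorem exists_verschiebung_eq {x : WittVector p R} (hx : x.coeff 0 = 0) :
    verschiebung (x.shift 1) = x :=
  (eq_iterate_verschiebung (n := 1) (by simpa using hx)).symm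

variable (p R) in
theorem coeff_zero_p_sub_teichmuller :
    ((p : WittVector p R) - teichmuller p (p : R)).coeff 0 = 0 := by
  change constantCoeff ((p : WittVector p R) - teichmuller p (p : R)) = 0
  rw [map_sub, map_natCast]
  exact sub_self _

/-- Multiplication by `p` maps `W(I)` into `W(J)` as soon as `J` contains `p I` and all `p`-th
powers of elements of `I`. -/
theorem p_mul_coeff_mem {I J : Ideal R} (hpow : ∀ a ∈ I, a ^ p ∈ J)
    (hmul : ∀ a ∈ I, (p : R) * a ∈ J) {x : WittVector p R} (hx : ∀ n, x.coeff n ∈ I) (n : ℕ) :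
    ((p : WittVector p R) * x).coeff n ∈ J := by
  set u := ((p : WittVector p R) - teichmuller p (p : R)).shift 1
  have hu : verschiebung u = (p : WittVector p R) - teichmuller p (p : R) :=
    exists_verschiebung_eq (coeff_zero_p_sub_teichmuller p R)
  have hpx : (p : WittVector p R) * x =
      verschiebung (u * frobenius x) + teichmuller p (p : R) * x := by
    rw [verschiebung_mul_frobenius, hu]
    ring
  rw [hpx]
  refine mem_ker_map_mk.1 (Ideal.add_mem _ (mem_ker_map_mk.2 fun n => ?_)
    (mem_ker_map_mk.2 fun n => ?_)) n
  · cases n with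
    | zero => simp
    | succ n =>
      rw [verschiebung_coeff_succ]
      exact mem_ker_map_mk.1 (Ideal.mul_mem_left _ _
        (mem_ker_map_mk.2 (frobenius_coeff_mem hpow hmul hx))) n
  · rw [coeff_teichmuller_mul]
    obtain ⟨k, hk⟩ := Nat.exists_eq_succ_of_ne_zero (pow_ne_zero n hp.out.ne_zero)
    rw [hk, pow_succ, mul_assoc]
    exact J.mul_mem_left _ (hmul _ (hx n))

/-- If `N` is a nil ideal of bounded index and `p` is nilpotent, then `W(N)` is killed by a power
of `p`. -/
theorem exists_p_pow_mul_eq_zero [Nontrivial R] {N : Ideal R} {m : ℕ}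
    (hN : ∀ a ∈ N, a ^ m = 0) (hpR : IsNilpotent (p : R)) :
    ∃ M : ℕ, ∀ x : WittVector p R, (∀ n, x.coeff n ∈ N) → (p : WittVector p R) ^ M * x = 0 := by
  obtain ⟨e, he⟩ := hpR
  have : CharP (R ⧸ Ideal.span {(p : R)}) p :=
    CharP.quotient R p fun h => h.not_isNilpotent ⟨e, he⟩
  refine ⟨e + m, fun x hx => ?_⟩
  have step (j : ℕ) (n : ℕ) :
      ((p : WittVector p R) ^ (j + m) * x).coeff n ∈ Ideal.span {(p : R) ^ (j + 1)} := by
    induction j generalizing n with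
    | zero =>
      rw [zero_add, zero_add, pow_one, ← Ideal.Quotient.eq_zero_iff_mem, ← map_coeff, map_mul,
        map_pow, map_natCast, mul_comm]
      rcases lt_or_ge n m with h | h
      · exact mul_pow_charP_coeff_zero _ h
      · obtain ⟨i, rfl⟩ := Nat.exists_eq_add_of_le' h
        rw [mul_pow_charP_coeff_succ, map_coeff, ← map_pow,
          pow_eq_zero_of_le (Nat.lt_pow_self hp.out.one_lt).le (hN _ (hx i)), map_zero]
    | succ j ih =>
      rw [show j + 1 + m = j + m + 1 by ring, pow_succ' (p : WittVector p R), mul_assoc]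
      refine p_mul_coeff_mem (fun a ha => ?_) (fun a ha => ?_) ih n
      · refine Ideal.mem_span_singleton.2 (dvd_trans (pow_dvd_pow _ ?_)
          ((pow_mul (p : R) (j + 1) p).symm ▸ pow_dvd_pow_of_dvd (Ideal.mem_span_singleton.1 ha) p))
        nlinarith [hp.out.two_le]
      · rw [pow_succ']
        exact Ideal.mem_span_singleton.2 (mul_dvd_mul_left _ (Ideal.mem_span_singleton.1 ha))
  ext n
  simpa [pow_succ, he] using step e n

/-- If `N` is a nil ideal of bounded index and `p` is nilpotent, then `W(N)` is a nil ideal of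
bounded index. -/
theorem exists_pow_eq_zero [Nontrivial R] {N : Ideal R} {m : ℕ}
    (hN : ∀ a ∈ N, a ^ m = 0) (hpR : IsNilpotent (p : R)) :
    ∃ L : ℕ, ∀ x : WittVector p R, (∀ n, x.coeff n ∈ N) → x ^ L = 0 := by
  obtain ⟨M, hM⟩ := exists_p_pow_mul_eq_zero (p := p) hN hpR
  have hv (y : WittVector p R) (n : ℕ) :
      verschiebung y ^ (n + 1) = verschiebung ((p : WittVector p R) ^ n * y ^ (n + 1)) := by
    induction n with
    | zero => simp
    | succ n ih =>
      rw [pow_succ, ih, ← verschiebung_mul_frobenius, frobenius_verschiebung]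
      congr 1
      ring
  refine ⟨m + (M + 1) - 1, fun x hx => ?_⟩
  have hx0 : (x - teichmuller p (x.coeff 0)).coeff 0 = 0 := by
    change constantCoeff (x - teichmuller p (x.coeff 0)) = 0
    rw [map_sub]
    exact sub_self _
  set y := (x - teichmuller p (x.coeff 0)).shift 1
  have hy : verschiebung y = x - teichmuller p (x.coeff 0) := exists_verschiebung_eq hx0
  have hyN : y ∈ RingHom.ker (map (p := p) (Ideal.Quotient.mk N)) := by
    refine mem_ker_map_mk.2 fun n => ?_
    have h : verschiebung y ∈ RingHom.ker (map (p := p) (Ideal.Quotient.mk N)) := by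
      rw [hy]
      refine Ideal.sub_mem _ (mem_ker_map_mk.2 hx) (mem_ker_map_mk.2 fun n => ?_)
      cases n with
      | zero => exact hx 0
      | succ n => exact N.zero_mem
    simpa using mem_ker_map_mk.1 h (n + 1)
  rw [← add_sub_cancel (teichmuller p (x.coeff 0)) x, ← hy]
  refine (Commute.all _ _).add_pow_add_eq_zero_of_pow_eq_zero ?_ ?_
  · rw [← map_pow, hN _ (hx 0), teichmuller_zero]
  · rw [hv, hM _ (mem_ker_map_mk.1 (Ideal.pow_mem_of_mem _ hyN _ M.succ_pos)), map_zero]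

/-- Ring homomorphisms out of the Witt vectors of a perfect ring lift uniquely along a homomorphism
whose kernel is nil of bounded index and killed by a power of `p`. -/
theorem eq_of_comp_eq_id {k : Type*} [CommRing k] [CharP k p] [PerfectRing k p]
    {A : Type*} [CommRing A] (q : A →+* WittVector p k) {M L : ℕ}
    (hM : ∀ x ∈ RingHom.ker q, (p : A) ^ M * x = 0) (hL : ∀ x ∈ RingHom.ker q, x ^ L = 0)
    {s t : WittVector p k →+* A} (hs : q.comp s = RingHom.id _) (ht : q.comp t = RingHom.id _) :
    s = t := by
  have hsub (y : WittVector p k) : s y - t y ∈ RingHom.ker q := by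
    rw [RingHom.mem_ker, map_sub]
    simp only [RingHom.ext_iff, RingHom.comp_apply, RingHom.id_apply] at hs ht
    rw [hs, ht, sub_self]
  have hker {a : A} {j : ℕ} (h : (p : A) ^ j * a ∈ RingHom.ker q) : a ∈ RingHom.ker q := by
    induction j with
    | zero => simpa using h
    | succ j ih =>
      refine ih (eq_zero_of_p_mul_eq_zero _ ?_)
      rw [← map_natCast q p, ← map_mul, ← RingHom.mem_ker]
      convert h using 1
      ring
  have hT (a : k) : s (teichmuller p a) = t (teichmuller p a) := by
    obtain ⟨b, rfl⟩ := (iterateFrobeniusEquiv k p (L + M)).surjective a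
    rw [iterateFrobeniusEquiv_def, map_pow, map_pow, map_pow, pow_add, pow_mul, pow_mul]
    set α := s (teichmuller p b)
    set β := t (teichmuller p b)
    have hdvd : (p : A) ∣ α ^ p ^ L - β ^ p ^ L := by
      obtain ⟨r, hr⟩ := exists_add_pow_prime_pow_eq hp.out (α - β) β L
      rw [sub_add_cancel, pow_eq_zero_of_le (Nat.lt_pow_self hp.out.one_lt).le
        (hL _ (hsub (teichmuller p b))), zero_add] at hr
      exact ⟨(α - β) * β * r, by rw [hr]; ring⟩
    obtain ⟨c, hc⟩ := dvd_sub_pow_of_dvd_sub hdvd M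
    rw [← sub_eq_zero, hc, pow_succ', mul_assoc, hM c, mul_zero]
    refine hker (j := M + 1) (hc ▸ ?_)
    simp only [α, β, ← map_pow]
    exact hsub _
  ext y
  obtain ⟨c, hc⟩ := dvd_sub_sum_teichmuller_iterateFrobeniusEquiv_coeff y M
  rw [sub_eq_iff_eq_add] at hc
  rw [← sub_eq_zero, hc]
  simp only [map_add, map_mul, map_sum, map_pow, map_natCast, hT]
  rw [add_sub_add_right_eq_sub, ← mul_sub, pow_succ', mul_assoc, hM _ (hsub c), mul_zero]

section Filtration

/-- The Rees subring of `R[X]` attached to a multiplicative filtration of `R` by ideals. -/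
def reesSubring (J : ℕ → Ideal R) (h0 : J 0 = ⊤) (hJ : ∀ i j, J i * J j ≤ J (i + j)) :
    Subring (Polynomial R) where
  carrier := {f | ∀ i, f.coeff i ∈ J i}
  zero_mem' i := by simp
  one_mem' i := by
    rw [Polynomial.coeff_one]
    split_ifs with h
    · simp [h, h0]
    · exact (J i).zero_mem
  add_mem' hf hg i := by
    rw [Polynomial.coeff_add]
    exact (J i).add_mem (hf i) (hg i)
  neg_mem' hf i := by
    rw [Polynomial.coeff_neg]
    exact (J i).neg_mem (hf i)
  mul_mem' hf hg i := by
    rw [Polynomial.coeff_mul]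
    refine (J i).sum_mem fun x hx => ?_
    rw [← Finset.HasAntidiagonal.mem_antidiagonal.1 hx]
    exact hJ _ _ (Ideal.mul_mem_mul (hf _) (hg _))

theorem mem_range_map_subtype {S : Subring R} {x : WittVector p R} :
    x ∈ (map (p := p) S.subtype).range ↔ ∀ n, x.coeff n ∈ S := by
  constructor
  · rintro ⟨y, rfl⟩ n
    rw [map_coeff]
    exact (y.coeff n).2
  · intro h
    exact ⟨WittVector.mk p fun n => ⟨x.coeff n, h n⟩, by ext n; simp⟩

/-- For a multiplicative filtration `J` of `R` by ideals, the Witt vectors whose `n`-th coefficient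
lies in `J (p ^ n)` form an ideal. -/
noncomputable def filtrationIdeal (J : ℕ → Ideal R) (h0 : J 0 = ⊤)
    (hJ : ∀ i j, J i * J j ≤ J (i + j)) :
    Ideal (WittVector p R) :=
  let S := (map (p := p) (reesSubring J h0 hJ).subtype).range
  have hC (w : WittVector p R) : map Polynomial.C w ∈ S := mem_range_map_subtype.2 fun n i => by
    rw [map_coeff, Polynomial.coeff_C]
    split_ifs with h
    · simp [h, h0]
    · exact (J i).zero_mem
  have hmem (x : WittVector p R) : (∀ n, x.coeff n ∈ J (p ^ n)) ↔
      teichmuller p Polynomial.X * map Polynomial.C x ∈ S := by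
    simp only [S, mem_range_map_subtype, coeff_teichmuller_mul, map_coeff]
    refine forall_congr' fun n => ⟨fun h i => ?_, fun h => ?_⟩
    · rw [mul_comm, Polynomial.coeff_C_mul_X_pow]
      split_ifs with hi
      · exact hi ▸ h
      · exact (J i).zero_mem
    · have h := h (p ^ n)
      rwa [mul_comm, Polynomial.coeff_C_mul_X_pow, if_pos rfl] at h
  { carrier := {x | ∀ n, x.coeff n ∈ J (p ^ n)}
    zero_mem' n := by simp
    add_mem' {x y} hx hy := by
      refine (hmem _).2 ?_
      rw [map_add, mul_add]
      exact S.add_mem ((hmem x).1 hx) ((hmem y).1 hy)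
    smul_mem' w x hx := by
      refine (hmem _).2 ?_
      rw [smul_eq_mul, map_mul, mul_left_comm]
      exact S.mul_mem (hC w) ((hmem x).1 hx) }

theorem pow_ceilDiv_mul_le (I : Ideal R) {q : ℕ} (hq : 0 < q) (i j : ℕ) :
    I ^ (i ⌈/⌉ q) * I ^ (j ⌈/⌉ q) ≤ I ^ ((i + j) ⌈/⌉ q) := by
  rw [← pow_add]
  refine Ideal.pow_le_pow_right ((ceilDiv_le_iff_le_mul hq).2 ?_)
  rw [mul_add]
  exact add_le_add (le_smul_ceilDiv hq) (le_smul_ceilDiv hq)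

/-- The ideal of Witt vectors whose `n`-th coefficient lies in `I ^ ⌈p ^ n / p ^ k⌉`. -/
noncomputable def decayIdeal (p : ℕ) [hp : Fact p.Prime] (I : Ideal R) (k : ℕ) :
    Ideal (WittVector p R) :=
  filtrationIdeal (fun i => I ^ (i ⌈/⌉ p ^ k)) (by simp)
    (pow_ceilDiv_mul_le I (pow_pos hp.out.pos k))

theorem mem_decayIdeal {I : Ideal R} {k : ℕ} {x : WittVector p R} :
    x ∈ decayIdeal p I k ↔ ∀ n, x.coeff n ∈ I ^ (p ^ n ⌈/⌉ p ^ k) :=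
  Iff.rfl

theorem mem_decayIdeal_of_coeff {I : Ideal R} {k : ℕ} {x : WittVector p R}
    (hx : ∀ n, x.coeff n ∈ I) (hx0 : ∀ n ≥ k, x.coeff n = 0) : x ∈ decayIdeal p I k := by
  refine mem_decayIdeal.2 fun n => ?_
  rcases lt_or_ge n k with h | h
  · refine Ideal.pow_le_pow_right (n := 1) ?_ (by simpa using hx n)
    rw [ceilDiv_le_iff_le_mul (pow_pos hp.out.pos k), mul_one]
    exact Nat.pow_le_pow_right hp.out.pos h.le
  · rw [hx0 n h]
    exact Ideal.zero_mem _

theorem mem_hatW_of_mem_decayIdeal {I : Ideal R} (hI : IsNilpotent I) {k : ℕ}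
    {x : WittVector p R} (hx : x ∈ decayIdeal p I k) : x ∈ hatW p R := by
  obtain ⟨e, he⟩ := hI
  have hq : 0 < p ^ k := pow_pos hp.out.pos k
  have hlt (n c : ℕ) (h : p ^ k * c < p ^ n) : c < p ^ n ⌈/⌉ p ^ k := by
    rwa [← not_le, ceilDiv_le_iff_le_mul hq, not_le]
  refine ⟨fun n => ⟨e, ?_⟩, k + e, fun n hn => ?_⟩
  · have h1 : x.coeff n ∈ I := by
      have := Ideal.pow_le_pow_right (I := I) (hlt n 0 (by simpa using pow_pos hp.out.pos n)) (hx n)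
      simpa using this
    simpa [he] using Ideal.pow_mem_pow h1 e
  · have h1 : e ≤ p ^ n ⌈/⌉ p ^ k := by
      refine (hlt n e ?_).le
      calc
        p ^ k * e < p ^ k * p ^ e :=
          Nat.mul_lt_mul_of_pos_left (Nat.lt_pow_self hp.out.one_lt) hq
        _ = p ^ (k + e) := (pow_add _ _ _).symm
        _ ≤ p ^ n := Nat.pow_le_pow_right hp.out.pos hn
    simpa [he] using Ideal.pow_le_pow_right (I := I) h1 (hx n)

theorem exists_fg_of_mem_hatW {x : WittVector p R} (hx : x ∈ hatW p R) :
    ∃ (I : Ideal R) (k : ℕ), I.FG ∧ I ≤ nilradical R ∧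
      ∀ I' ≥ I, ∀ k' ≥ k, x ∈ decayIdeal p I' k' := by
  classical
  obtain ⟨hnil, k, hk⟩ := hx
  refine ⟨Ideal.span ((Finset.range k).image x.coeff), k, ⟨_, rfl⟩, ?_, fun I' hI' k' hk' => ?_⟩
  · rw [Ideal.span_le]
    intro a ha
    obtain ⟨n, -, rfl⟩ := Finset.mem_image.1 (Finset.mem_coe.1 ha)
    exact mem_nilradical.2 (hnil n)
  · refine mem_decayIdeal_of_coeff (fun n => hI' ?_) fun n hn => hk n (hk'.le.trans hn)
    rcases lt_or_ge n k with h | h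
    · exact Ideal.subset_span (Finset.mem_coe.2
        (Finset.mem_image_of_mem _ (Finset.mem_range.2 h)))
    · rw [hk n h]
      exact Ideal.zero_mem _

variable (p R) in
/-- The set `Ŵ(N_R)`, as an ideal of `W(R)`. -/
def hatIdeal : Ideal (WittVector p R) where
  carrier := hatW p R
  zero_mem' := ⟨fun n => by simp, 0, fun n _ => by simp⟩
  add_mem' {x y} hx hy := by
    obtain ⟨I, k, hfg, hI, h⟩ := exists_fg_of_mem_hatW hx
    obtain ⟨I', k', hfg', hI', h'⟩ := exists_fg_of_mem_hatW hy
    refine mem_hatW_of_mem_decayIdeal (I := I ⊔ I') (k := max k k')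
      ((Ideal.FG.isNilpotent_iff_le_nilradical (Submodule.FG.sup hfg hfg')).2
        (sup_le hI hI')) (Ideal.add_mem _ ?_ ?_)
    · exact h _ le_sup_left _ (le_max_left _ _)
    · exact h' _ le_sup_right _ (le_max_right _ _)
  smul_mem' w x hx := by
    obtain ⟨I, k, hfg, hI, h⟩ := exists_fg_of_mem_hatW hx
    exact mem_hatW_of_mem_decayIdeal (hfg.isNilpotent_iff_le_nilradical.2 hI)
      (Ideal.mul_mem_left _ w (h I le_rfl k le_rfl))

theorem mem_hatIdeal {x : WittVector p R} : x ∈ hatIdeal p R ↔ x ∈ hatW p R :=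
  Iff.rfl

theorem verschiebung_mem_hatIdeal {x : WittVector p R} :
    verschiebung x ∈ hatIdeal p R ↔ x ∈ hatIdeal p R := by
  refine ⟨fun ⟨h, N, hN⟩ => ⟨fun n => h (n + 1), N, fun n hn => hN (n + 1) (by lia)⟩,
    fun ⟨h, N, hN⟩ => ⟨fun n => ?_, N + 1, fun n hn => ?_⟩⟩
  · cases n with
    | zero => simp
    | succ n => exact h n
  · cases n with
    | zero => simp
    | succ n => exact hN n (by lia)

theorem teichmuller_mem_hatIdeal {r : R} (hr : IsNilpotent r) :
    teichmuller p r ∈ hatIdeal p R := by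
  refine ⟨fun n => ?_, 1, fun n hn => teichmuller_coeff_pos p r n hn⟩
  cases n with
  | zero => exact hr
  | succ n => exact IsNilpotent.zero

end Filtration

section Admissible

theorem _root_.IsAdmissible.charP [Nontrivial R] (hR : IsAdmissible p R) :
    CharP (R ⧸ nilradical R) p :=
  have : Nontrivial (R ⧸ nilradical R) := Ideal.Quotient.nontrivial_iff.2 fun h =>
    not_isNilpotent_one (mem_nilradical.1 ((Ideal.eq_top_iff_one _).1 h))
  (CharP.charP_iff_prime_eq_zero hp.out).2 hR.2.1

/-- A section of `W(R) → W(R_red)` commutes with the Frobenius when `R` is admissible. -/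
theorem _root_.IsAdmissible.frobenius_section [Nontrivial R] (hR : IsAdmissible p R)
    {s : WittVector p (R ⧸ nilradical R) →+* WittVector p R}
    (hs : (map (Ideal.Quotient.mk (nilradical R))).comp s = RingHom.id _)
    (y : WittVector p (R ⧸ nilradical R)) : frobenius (s y) = s (frobenius y) := by
  have := hR.charP
  have : PerfectRing (R ⧸ nilradical R) p := ⟨hR.2.2⟩
  obtain ⟨m, -, hm⟩ := hR.1
  obtain ⟨M, hM⟩ := exists_p_pow_mul_eq_zero (p := p) hm hR.isNilpotent
  obtain ⟨L, hL⟩ := exists_pow_eq_zero (p := p) hm hR.isNilpotent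
  have h := eq_of_comp_eq_id (map (Ideal.Quotient.mk (nilradical R)))
    (fun x hx => hM x (mem_ker_map_mk.1 hx)) (fun x hx => hL x (mem_ker_map_mk.1 hx)) hs
    (t := (frobenius.comp s).comp (frobeniusEquiv p (R ⧸ nilradical R)).symm.toRingHom) (by
      ext1 y
      have hs' (z) : map (Ideal.Quotient.mk (nilradical R)) (s z) = z := RingHom.congr_fun hs z
      simp only [RingHom.comp_apply, map_frobenius, hs', RingHom.id_apply]
      exact (frobeniusEquiv p (R ⧸ nilradical R)).apply_symm_apply y)
  conv_rhs => rw [h]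
  simp only [RingHom.comp_apply]
  congr 2
  exact ((frobeniusEquiv p (R ⧸ nilradical R)).symm_apply_apply y).symm

/-- An element `u` with `v(u) = p - [p]` is a unit: its image in `W(R_red)` is `1`. -/
theorem _root_.IsAdmissible.isUnit_of_verschiebung_eq [Nontrivial R] (hR : IsAdmissible p R)
    {u : WittVector p R} (hu : verschiebung u = (p : WittVector p R) - teichmuller p (p : R)) :
    IsUnit u := by
  have := hR.charP
  obtain ⟨m, -, hm⟩ := hR.1
  obtain ⟨L, hL⟩ := exists_pow_eq_zero (p := p) hm hR.isNilpotent
  have h1 : map (Ideal.Quotient.mk (nilradical R)) u = 1 := by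
    refine verschiebung_injective p _ ?_
    rw [← map_verschiebung, hu, map_sub, map_natCast, map_teichmuller, map_natCast, hR.2.1,
      teichmuller_zero, sub_zero, ← one_mul ((p : ℕ) : WittVector p (R ⧸ nilradical R)),
      ← verschiebung_frobenius, map_one]
  rw [← add_sub_cancel 1 u]
  refine IsNilpotent.isUnit_one_add ⟨L, hL _ (mem_ker_map_mk.1 ?_)⟩
  rw [RingHom.mem_ker, map_sub, h1, map_one, sub_self]

variable {s : WittVector p (R ⧸ nilradical R) →+* WittVector p R}

theorem section_add_mem_zinkSet (y : WittVector p (R ⧸ nilradical R)) {z : WittVector p R}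
    (hz : z ∈ hatIdeal p R) : s y + z ∈ zinkSet p R s :=
  ⟨y, z, hz, rfl⟩

theorem map_mk_of_mem_hatIdeal {z : WittVector p R} (hz : z ∈ hatIdeal p R) :
    map (Ideal.Quotient.mk (nilradical R)) z = 0 :=
  mem_ker_map_mk.2 fun n => mem_nilradical.2 (hz.1 n)

theorem _root_.IsAdmissible.section_p_mul [Nontrivial R] (hR : IsAdmissible p R)
    (hs : (map (Ideal.Quotient.mk (nilradical R))).comp s = RingHom.id _)
    {u : WittVector p R} (hu : verschiebung u = (p : WittVector p R) - teichmuller p (p : R))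
    (y : WittVector p (R ⧸ nilradical R)) :
    s (p * y) = verschiebung (u * s (frobenius y)) + s y * teichmuller p (p : R) := by
  rw [← hR.frobenius_section hs, verschiebung_mul_frobenius, hu, map_mul, map_natCast]
  ring

theorem _root_.IsAdmissible.verschiebung_mul_mem_zinkSet [Nontrivial R] (hR : IsAdmissible p R)
    (hs : (map (Ideal.Quotient.mk (nilradical R))).comp s = RingHom.id _)
    {u : WittVector p R} (hu : verschiebung u = (p : WittVector p R) - teichmuller p (p : R))
    {x : WittVector p R} (hx : x ∈ zinkSet p R s) : verschiebung (u * x) ∈ zinkSet p R s := by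
  have := hR.charP
  have : PerfectRing (R ⧸ nilradical R) p := ⟨hR.2.2⟩
  obtain ⟨y, z, hz, rfl⟩ := hx
  obtain ⟨y, rfl⟩ := (frobenius_bijective p (R ⧸ nilradical R)).surjective y
  have h : verschiebung (u * (s (frobenius y) + z)) =
      s (p * y) + (verschiebung (u * z) - s y * teichmuller p (p : R)) := by
    rw [hR.section_p_mul hs hu, mul_add, map_add]
    ring
  rw [h]
  exact section_add_mem_zinkSet _ (Ideal.sub_mem _
    (verschiebung_mem_hatIdeal.2 (Ideal.mul_mem_left _ _ hz))
    (Ideal.mul_mem_left _ _ (teichmuller_mem_hatIdeal hR.isNilpotent)))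

theorem _root_.IsAdmissible.exists_eq_verschiebung_mul [Nontrivial R] (hR : IsAdmissible p R)
    (hs : (map (Ideal.Quotient.mk (nilradical R))).comp s = RingHom.id _)
    {u : WittVector p R} (hu : verschiebung u = (p : WittVector p R) - teichmuller p (p : R))
    {x : WittVector p R} (hx : x ∈ zinkSet p R s) (hx0 : x.coeff 0 = 0) :
    ∃ y ∈ zinkSet p R s, x = verschiebung (u * y) := by
  have := hR.charP
  have : PerfectRing (R ⧸ nilradical R) p := ⟨hR.2.2⟩
  obtain ⟨y, z, hz, rfl⟩ := hx
  have hs' (z) : map (Ideal.Quotient.mk (nilradical R)) (s z) = z := RingHom.congr_fun hs z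
  have hy0 : y.coeff 0 = 0 := by
    have h : (map (Ideal.Quotient.mk (nilradical R)) (s y + z)).coeff 0 = 0 := by
      rw [map_coeff, hx0, map_zero]
    rwa [map_add, hs', map_mk_of_mem_hatIdeal hz, add_zero] at h
  obtain ⟨y, rfl⟩ := Ideal.mem_span_singleton.1 ((mem_span_p_iff_coeff_zero_eq_zero y).2 hy0)
  set z' := s y * teichmuller p (p : R) + z with hz'
  have hxz : s (p * y) + z = verschiebung (u * s (frobenius y)) + z' := by
    rw [hR.section_p_mul hs hu, hz', add_assoc]
  have hz'mem : z' ∈ hatIdeal p R :=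
    Ideal.add_mem _ (Ideal.mul_mem_left _ _ (teichmuller_mem_hatIdeal hR.isNilpotent)) hz
  have hz'0 : z'.coeff 0 = 0 := by
    rw [hxz, add_coeff_zero, verschiebung_coeff_zero, zero_add] at hx0
    exact hx0
  obtain ⟨w, hw⟩ : ∃ w, verschiebung w = z' := ⟨_, exists_verschiebung_eq hz'0⟩
  obtain ⟨c, hc⟩ := (hR.isUnit_of_verschiebung_eq hu).exists_right_inv
  rw [← hw, verschiebung_mem_hatIdeal] at hz'mem
  refine ⟨_, section_add_mem_zinkSet (frobenius y) (Ideal.mul_mem_left _ c hz'mem), ?_⟩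
  rw [hxz, ← hw, mul_add, ← mul_assoc, hc, one_mul, map_add]

theorem exists_mem_zinkSet_coeff_zero
    (hs : (map (Ideal.Quotient.mk (nilradical R))).comp s = RingHom.id _) (r : R) :
    ∃ x ∈ zinkSet p R s, x.coeff 0 = r := by
  set y := teichmuller p (Ideal.Quotient.mk (nilradical R) r)
  refine ⟨_, section_add_mem_zinkSet y (teichmuller_mem_hatIdeal (p := p)
    (r := r - (s y).coeff 0) ?_), ?_⟩
  · rw [← mem_nilradical, ← Ideal.Quotient.eq_zero_iff_mem, map_sub, ← map_coeff,
      ← RingHom.comp_apply, hs]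
    exact sub_self _
  · rw [add_coeff_zero, teichmuller_coeff_zero, add_sub_cancel]

end Admissible

end Generic
end WittVector

/-- Let `p = 2` and `R` admissible.  The element
`2·1 − [2·1_R]` of `W(R)` has zeroth coefficient `0`, hence equals `v(u₀)` for
a unique `u₀`, which is a unit; moreover `𝕎(R)` is stable under
`x ↦ v(u₀·x)`, every element of `𝕎(R)` with zeroth component `0` is of the
form `v(u₀·y)` with `y ∈ 𝕎(R)`, and `w₀ : 𝕎(R) → R` is surjective. -/
theorem modified_verschiebung_p_two (R : Type*) [CommRing R]
    (hR : IsAdmissible 2 R)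
    (s : WittVector 2 (R ⧸ nilradical R) →+* WittVector 2 R)
    (hs : (WittVector.map (Ideal.Quotient.mk (nilradical R))).comp s = RingHom.id _) :
    ((2 : WittVector 2 R) - WittVector.teichmuller 2 (2 : R)).coeff 0 = 0 ∧
    ∃ u₀ : WittVector 2 R,
      WittVector.verschiebung u₀ =
        (2 : WittVector 2 R) - WittVector.teichmuller 2 (2 : R) ∧
      (∀ u : WittVector 2 R,
        WittVector.verschiebung u =
          (2 : WittVector 2 R) - WittVector.teichmuller 2 (2 : R) → u = u₀) ∧
      IsUnit u₀ ∧
      Function.Injective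
        (fun x : WittVector 2 R => WittVector.verschiebung (u₀ * x)) ∧
      (∀ x ∈ zinkSet 2 R s, WittVector.verschiebung (u₀ * x) ∈ zinkSet 2 R s) ∧
      (∀ x ∈ zinkSet 2 R s, x.coeff 0 = 0 →
        ∃ y ∈ zinkSet 2 R s, x = WittVector.verschiebung (u₀ * y)) ∧
      (∀ r : R, ∃ x ∈ zinkSet 2 R s, x.coeff 0 = r) := by
  cases subsingleton_or_nontrivial R with
  | inl _ =>
    have : Subsingleton (WittVector 2 R) := ⟨fun x y => by ext n; exact Subsingleton.elim _ _⟩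
    exact ⟨Subsingleton.elim _ _, 0, Subsingleton.elim _ _, fun u _ => Subsingleton.elim _ _,
      isUnit_of_subsingleton _, Function.injective_of_subsingleton _,
      fun x hx => by rwa [Subsingleton.elim (WittVector.verschiebung (0 * x)) x],
      fun x hx _ => ⟨x, hx, Subsingleton.elim _ _⟩,
      WittVector.exists_mem_zinkSet_coeff_zero hs⟩
  | inr _ =>
    have h0 := WittVector.coeff_zero_p_sub_teichmuller 2 R
    have hu := WittVector.exists_verschiebung_eq h0
    have hunit := hR.isUnit_of_verschiebung_eq hu
    refine ⟨mod_cast h0, _, mod_cast hu, fun u h => ?_, hunit, ?_,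
      fun x hx => hR.verschiebung_mul_mem_zinkSet hs hu hx,
      fun x hx => hR.exists_eq_verschiebung_mul hs hu hx,
      WittVector.exists_mem_zinkSet_coeff_zero hs⟩
    · exact WittVector.verschiebung_injective 2 R (h.trans (mod_cast hu.symm))
    · exact (WittVector.verschiebung_injective 2 R).comp hunit.isRegular.left
end
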